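/- Let A, B, P, X, Y, Z be points on a sphere arising as the radial projection of a linearly embedded graph containing the path X–A, A–B, B–P, P–Y, Y–X structure with edges YP, AB, XY, BP. If at the crossings YP is over AB, AB is over XY, and XY is over BP, then no such linear embedding exists. -/

import Mathlib

noncomputable section

/-- Points of `ℝ³`. -/
abbrev E3 := EuclideanSpace ℝ (Fin 3)

/-- In the radial projection from the point `O`, the segment `AB` passes *over*
the segment `XY` at a crossing: there are interior points `p` of `AB` and `q` of
`XY` lying on the same ray from `O` (so they project to the same point of a
sphere centered at `O`) with `p` strictly closer to `O` than `q`. -/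
def Over (O A B X Y : E3) : Prop :=
  ∃ p ∈ openSegment ℝ A B, ∃ q ∈ openSegment ℝ X Y,
    SameRay ℝ (p - O) (q - O) ∧ dist O p < dist O q

/-- Scalar planar lemma: `a = (1,0)`, `b = (0,1)`, `y = (c,d)`, `x = (e,f)`, `p = (g,h)`. -/
theorem planar_aux (c d e f g h a1 b1 y1 p1 a2 b2 x2 y2 b3 p3 x3 y3 : ℝ)
    (ha1 : 0 < a1) (hb1 : 0 < b1) (hy1 : 0 < y1) (hp1 : 0 < p1)
    (ha2 : 0 < a2) (hb2 : 0 < b2) (hx2 : 0 < x2) (hy2 : 0 < y2)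
    (hb3 : 0 < b3) (hp3 : 0 < p3) (hx3 : 0 < x3) (hy3 : 0 < y3)
    (e11 : y1 * c + p1 * g = a1) (e12 : y1 * d + p1 * h = b1)
    (e21 : a2 = x2 * e + y2 * c) (e22 : b2 = x2 * f + y2 * d)
    (e31 : x3 * e + y3 * c = p3 * g) (e32 : x3 * f + y3 * d = b3 + p3 * h) :
    (0 ≤ c ∧ 0 ≤ d) ∨
    (∃ α β : ℝ, 0 ≤ α ∧ 0 ≤ β ∧ α * e + β * c = 0 ∧ α * f + β * d = 1) ∨
    (∃ α β : ℝ, 0 ≤ α ∧ 0 ≤ β ∧ 0 < α + β ∧ α * e + β * c = 0 ∧ α * f + β * d = 0) ∨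
    (0 ≤ g ∧ 0 ≤ h ∧ ∃ α β : ℝ, 0 ≤ α ∧ 0 ≤ β ∧ α * e + β * c = g ∧ α * f + β * d = h) := by
  by_cases hcd : 0 ≤ c ∧ 0 ≤ d
  · exact Or.inl hcd
  right
  have key : x2 * (f * c - e * d) = b2 * c - a2 * d := by rw [e21, e22]; ring
  have neg_case : 0 < e → c < 0 → f * c - e * d < 0 →
      ∃ α β : ℝ, 0 ≤ α ∧ 0 ≤ β ∧ α * e + β * c = 0 ∧ α * f + β * d = 1 := by
    intro he hc hD
    have hD' : 0 < e * d - f * c := by linarith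
    refine ⟨-c / (e * d - f * c), e / (e * d - f * c), ?_, ?_, ?_, ?_⟩
    · exact div_nonneg (by linarith) hD'.le
    · exact div_nonneg he.le hD'.le
    · rw [div_mul_eq_mul_div, div_mul_eq_mul_div, ← add_div, div_eq_iff hD'.ne']; ring
    · rw [div_mul_eq_mul_div, div_mul_eq_mul_div, ← add_div, div_eq_iff hD'.ne']; ring
  rcases le_or_gt 0 d with hd | hd
  · have hc : c < 0 := by
      by_contra hc
      exact hcd ⟨not_lt.mp hc, hd⟩
    have he : 0 < e := by
      by_contra he
      have := mul_neg_of_pos_of_neg hy2 hc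
      have := mul_nonneg hx2.le (neg_nonneg.mpr (not_lt.mp he))
      linarith
    left
    apply neg_case he hc
    by_contra hD
    have h1 := mul_nonneg hx2.le (not_lt.mp hD)
    have h2 := mul_neg_of_pos_of_neg hb2 hc
    have h3 := mul_nonneg ha2.le hd
    linarith
  have hf : 0 < f := by
    by_contra hf
    have := mul_neg_of_pos_of_neg hy2 hd
    have := mul_nonneg hx2.le (neg_nonneg.mpr (not_lt.mp hf))
    linarith
  rcases le_or_gt e 0 with he | he
  · left
    have hc : 0 < c := by
      by_contra hc
      have := mul_nonneg hy2.le (neg_nonneg.mpr (not_lt.mp hc))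
      have := mul_nonneg hx2.le (neg_nonneg.mpr he)
      linarith
    have hD : 0 < f * c - e * d := by
      by_contra hD
      have h1 := mul_nonneg hx2.le (neg_nonneg.mpr (not_lt.mp hD))
      have h2 := mul_pos hb2 hc
      have h3 := mul_neg_of_pos_of_neg ha2 hd
      linarith
    refine ⟨c / (f * c - e * d), -e / (f * c - e * d), ?_, ?_, ?_, ?_⟩
    · exact div_nonneg hc.le hD.le
    · exact div_nonneg (by linarith) hD.le
    · rw [div_mul_eq_mul_div, div_mul_eq_mul_div, ← add_div, div_eq_iff hD.ne']; ring
    · rw [div_mul_eq_mul_div, div_mul_eq_mul_div, ← add_div, div_eq_iff hD.ne']; ring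
  rcases lt_trichotomy (f * c - e * d) 0 with hD | hD | hD
  · left
    apply neg_case he _ hD
    by_contra hc
    have := mul_nonneg hf.le (not_lt.mp hc)
    have := mul_neg_of_pos_of_neg he hd
    linarith
  · right; left
    have hc : c < 0 := by
      by_contra hc
      have := mul_nonneg hf.le (not_lt.mp hc)
      have := mul_neg_of_pos_of_neg he hd
      linarith
    exact ⟨-c, e, by linarith, he.le, by linarith, by ring, by linarith⟩
  · right; right
    have hh : 0 < h := by
      by_contra hh
      have := mul_neg_of_pos_of_neg hy1 hd
      have := mul_nonneg hp1.le (neg_nonneg.mpr (not_lt.mp hh))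
      linarith
    have hw : p3 * (f * g - e * h) = y3 * (f * c - e * d) + b3 * e := by
      linear_combination (-f) * e31 + e * e32
    have hW : 0 < f * g - e * h := by
      have := mul_pos hy3 hD
      have := mul_pos hb3 he
      by_contra hW
      have := mul_nonneg hp3.le (neg_nonneg.mpr (not_lt.mp hW))
      linarith
    have hg : 0 < g := by
      by_contra hg
      have := mul_nonneg hf.le (neg_nonneg.mpr (not_lt.mp hg))
      have := mul_pos he hh
      linarith
    have hV : 0 < h * c - g * d := by
      by_contra hV
      have h1 := mul_nonneg hf.le (neg_nonneg.mpr (not_lt.mp hV))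
      have h2 := mul_pos hh hD
      have h3 := mul_neg_of_neg_of_pos hd hW
      nlinarith
    refine ⟨hg.le, hh.le, (h * c - g * d) / (f * c - e * d), (f * g - e * h) / (f * c - e * d),
      div_nonneg hV.le hD.le, div_nonneg hW.le hD.le, ?_, ?_⟩
    · rw [div_mul_eq_mul_div, div_mul_eq_mul_div, ← add_div, div_eq_iff hD.ne']; ring
    · rw [div_mul_eq_mul_div, div_mul_eq_mul_div, ← add_div, div_eq_iff hD.ne']; ring

/-- Order property: the segment `uv` is nearer to the origin than `wz` wherever they overlap. -/
def Dom (u v w z : E3) : Prop :=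
  ∀ s1 s2 t1 t2 : ℝ, 0 ≤ s1 → 0 ≤ s2 → 0 ≤ t1 → 0 ≤ t2 → 0 < s1 + s2 →
    s1 • u + s2 • v = t1 • w + t2 • z → t1 + t2 < s1 + s2

theorem dom_of (u v w z : E3)
    (hd : ∀ s1 s2 t1 t2 : ℝ, 0 ≤ s1 → 0 ≤ s2 → 0 ≤ t1 → 0 ≤ t2 → s1 + s2 = 1 → t1 + t2 = 1 →
      s1 • u + s2 • v ≠ t1 • w + t2 • z)
    (a b c d : ℝ) (ha : 0 < a) (hb : 0 < b) (hc : 0 < c) (hd' : 0 < d)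
    (hlt : c + d < a + b) (h0 : a • u + b • v = c • w + d • z) : Dom u v w z := by
  intro s1 s2 t1 t2 hs1 hs2 ht1 ht2 hs heq
  by_contra hcon
  have hA : 0 ≤ (t1 + t2) - (s1 + s2) := by linarith
  have hB : 0 < (a + b) - (c + d) := by linarith
  set k := (t1 + t2) - (s1 + s2) with hk
  set l := (a + b) - (c + d) with hl
  have hN : 0 < k * (a + b) + l * (s1 + s2) := by positivity
  set N := k * (a + b) + l * (s1 + s2) with hNd
  have hN' : N = k * (c + d) + l * (t1 + t2) := by rw [hNd, hk, hl]; ring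
  refine hd ((k * a + l * s1) / N) ((k * b + l * s2) / N) ((k * c + l * t1) / N)
    ((k * d + l * t2) / N) (by positivity) (by positivity) (by positivity) (by positivity) ?_ ?_ ?_
  · rw [← add_div, div_eq_one_iff_eq hN.ne', hNd]; ring
  · rw [← add_div, div_eq_one_iff_eq hN.ne', hN']; ring
  · have : k • (a • u + b • v) + l • (s1 • u + s2 • v)
        = k • (c • w + d • z) + l • (t1 • w + t2 • z) := by rw [h0, heq]
    linear_combination (norm := module) N⁻¹ • this

theorem over_rel (O A B X Y : E3) (hO : O ∉ segment ℝ A B)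
    (hdis : Disjoint (segment ℝ A B) (segment ℝ X Y)) (h : Over O A B X Y) :
    Dom (A - O) (B - O) (X - O) (Y - O) ∧ ∃ a b c d : ℝ, 0 < a ∧ 0 < b ∧ 0 < c ∧ 0 < d ∧
      c + d < a + b ∧ a • (A - O) + b • (B - O) = c • (X - O) + d • (Y - O) := by
  obtain ⟨p, hp, q, hq, hray, hlt⟩ := h
  have hpO : p - O ≠ 0 := by
    intro h0
    exact hO ((sub_eq_zero.mp h0) ▸ openSegment_subset_segment ℝ A B hp)
  have hqO : q - O ≠ 0 := by
    intro h0
    rw [sub_eq_zero.mp h0, dist_self] at hlt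
    exact absurd hlt (not_lt.mpr dist_nonneg)
  obtain ⟨r, hr, hrq⟩ := hray.exists_pos_right hpO hqO
  have hr1 : r < 1 := by
    rw [dist_comm O p, dist_comm O q, dist_eq_norm, dist_eq_norm, hrq, norm_smul,
      Real.norm_of_nonneg hr.le] at hlt
    have : 0 < ‖q - O‖ := norm_pos_iff.mpr hqO
    by_contra h1
    nlinarith [not_lt.mp h1]
  obtain ⟨a, b, ha, hb, hab, rfl⟩ := hp
  obtain ⟨c, d, hc, hd, hcd, rfl⟩ := hq
  have hrel : a • (A - O) + b • (B - O) = (r * c) • (X - O) + (r * d) • (Y - O) := by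
    have e1 : a • (A - O) + b • (B - O) = a • A + b • B - O := by
      have : b = 1 - a := by linarith
      subst this; module
    have e2 : c • (X - O) + d • (Y - O) = c • X + d • Y - O := by
      have : d = 1 - c := by linarith
      subst this; module
    rw [e1, hrq, ← e2]; module
  have hs : r * c + r * d < a + b := by rw [← mul_add, hcd, hab]; linarith
  refine ⟨?_, a, b, r * c, r * d, ha, hb, by positivity, by positivity, hs, hrel⟩
  refine dom_of _ _ _ _ ?_ a b (r * c) (r * d) ha hb (by positivity) (by positivity) hs hrel
  intro s1 s2 t1 t2 hs1 hs2 ht1 ht2 h1 h2 heq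
  refine Set.disjoint_left.mp hdis (⟨s1, s2, hs1, hs2, h1, rfl⟩ : s1 • A + s2 • B ∈ segment ℝ A B)
    ⟨t1, t2, ht1, ht2, h2, ?_⟩
  have h1' : s2 = 1 - s1 := by linarith
  have h2' : t2 = 1 - t1 := by linarith
  subst h1' h2'
  linear_combination (norm := module) (-1 : ℝ) • heq

theorem vec_main (a b p x y : E3)
    (D1 : Dom y p a b) (D2 : Dom a b x y) (D3 : Dom x y b p)
    (hab0 : ∀ s t : ℝ, 0 ≤ s → 0 ≤ t → 0 < s + t → s • a + t • b ≠ 0)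
    (hxy0 : ∀ s t : ℝ, 0 ≤ s → 0 ≤ t → 0 < s + t → s • x + t • y ≠ 0)
    (hp0 : p ≠ 0)
    (a1 b1 y1 p1 a2 b2 x2 y2 b3 p3 x3 y3 : ℝ)
    (hy1 : 0 < y1) (hp1 : 0 < p1) (ha1 : 0 < a1) (hb1 : 0 < b1)
    (l1 : a1 + b1 < y1 + p1) (r1 : y1 • y + p1 • p = a1 • a + b1 • b)
    (ha2 : 0 < a2) (hb2 : 0 < b2) (hx2 : 0 < x2) (hy2 : 0 < y2)
    (l2 : x2 + y2 < a2 + b2) (r2 : a2 • a + b2 • b = x2 • x + y2 • y)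
    (hx3 : 0 < x3) (hy3 : 0 < y3) (hb3 : 0 < b3) (hp3 : 0 < p3)
    (l3 : b3 + p3 < x3 + y3) (r3 : x3 • x + y3 • y = b3 • b + p3 • p) : False := by
  -- `Y` is not in the cone of `A, B`
  have hY : ∀ α β : ℝ, 0 ≤ α → 0 ≤ β → y ≠ α • a + β • b := by
    intro α β hα hβ h
    have h1 := D1 1 0 α β (by norm_num) le_rfl hα hβ (by norm_num) (by rw [h]; module)
    have hpos : 0 < α + β := by
      by_contra hn
      have e1 : α = 0 := by linarith
      have e2 : β = 0 := by linarith
      refine hxy0 0 1 le_rfl zero_le_one (by norm_num) ?_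
      rw [h, e1, e2]; module
    have h2 := D2 α β 0 1 hα hβ le_rfl zero_le_one hpos (by rw [h]; module)
    linarith
  have hB : ∀ α β : ℝ, 0 ≤ α → 0 ≤ β → b ≠ α • x + β • y := by
    intro α β hα hβ h
    have h1 := D2 0 1 α β le_rfl zero_le_one hα hβ (by norm_num) (by rw [← h]; module)
    have hpos : 0 < α + β := by
      by_contra hn
      have e1 : α = 0 := by linarith
      have e2 : β = 0 := by linarith
      refine hab0 0 1 le_rfl zero_le_one (by norm_num) ?_
      rw [h, e1, e2]; module
    have h2 := D3 α β 1 0 hα hβ zero_le_one le_rfl hpos (by rw [← h]; module)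
    linarith
  have hP : ∀ α β γ δ : ℝ, 0 ≤ α → 0 ≤ β → 0 ≤ γ → 0 ≤ δ → p = α • a + β • b →
      p ≠ γ • x + δ • y := by
    intro α β γ δ hα hβ hγ hδ h h'
    have h1 := D1 0 1 α β le_rfl zero_le_one hα hβ (by norm_num) (by rw [← h]; module)
    have hpos : 0 < α + β := by
      by_contra hn
      have e1 : α = 0 := by linarith
      have e2 : β = 0 := by linarith
      refine hp0 ?_
      rw [h, e1, e2]; module
    have hpos' : 0 < γ + δ := by
      by_contra hn
      have e1 : γ = 0 := by linarith
      have e2 : δ = 0 := by linarith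
      refine hp0 ?_
      rw [h', e1, e2]; module
    have h2 := D2 α β γ δ hα hβ hγ hδ hpos (by rw [← h, ← h'])
    have h3 := D3 γ δ 0 1 hγ hδ le_rfl zero_le_one hpos' (by rw [← h']; module)
    linarith
  have hb0 : b ≠ 0 := by
    intro h
    exact hab0 0 1 le_rfl zero_le_one (by norm_num) (by rw [h]; module)
  -- `a` is not a multiple of `b`
  have hanb : ∀ k : ℝ, a ≠ k • b := by
    intro k hk
    have hkpos : 0 < a2 * k + b2 := by
      by_contra hn
      have hk0 : k < 0 := by
        by_contra hk0
        have := mul_nonneg ha2.le (not_lt.mp hk0)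
        linarith
      refine hab0 1 (-k) zero_le_one (by linarith) (by linarith) ?_
      rw [hk]; module
    refine hB (x2 / (a2 * k + b2)) (y2 / (a2 * k + b2)) (by positivity) (by positivity) ?_
    have h2 : (a2 * k + b2) • b = x2 • x + y2 • y := by rw [← r2, hk]; module
    have h3 : b = (a2 * k + b2)⁻¹ • ((a2 * k + b2) • b) := by
      rw [smul_smul, inv_mul_cancel₀ hkpos.ne', one_smul]
    rw [h2] at h3
    rw [h3.trans _]
    module
  have hind : ∀ s t : ℝ, s • a + t • b = 0 → s = 0 ∧ t = 0 := by
    intro s t h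
    have hs : s = 0 := by
      by_contra hs
      apply hanb (-t / s)
      have h3 : a = s⁻¹ • (s • a) := by rw [smul_smul, inv_mul_cancel₀ hs, one_smul]
      rw [eq_neg_of_add_eq_zero_left h] at h3
      rw [h3]; module
    refine ⟨hs, ?_⟩
    rw [hs, zero_smul, zero_add] at h
    exact (smul_eq_zero.mp h).resolve_right hb0
  have hxe : x = (a2 / x2) • a + (b2 / x2) • b + (-y2 / x2) • y := by
    have h3 : x = x2⁻¹ • (x2 • x) := by rw [smul_smul, inv_mul_cancel₀ hx2.ne', one_smul]
    rw [← sub_eq_of_eq_add r2] at h3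
    rw [h3]; module
  have hpe : p = (a1 / p1) • a + (b1 / p1) • b + (-y1 / p1) • y := by
    have h3 : p = p1⁻¹ • (p1 • p) := by rw [smul_smul, inv_mul_cancel₀ hp1.ne', one_smul]
    rw [eq_sub_of_add_eq' r1] at h3
    rw [h3]; module
  -- the combined relation between `a, b, y`
  obtain ⟨ca, hca⟩ : ∃ ca, ca = x3 * (a2 / x2) - p3 * (a1 / p1) := ⟨_, rfl⟩
  obtain ⟨cb, hcb⟩ : ∃ cb, cb = x3 * (b2 / x2) - b3 - p3 * (b1 / p1) := ⟨_, rfl⟩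
  obtain ⟨cy, hcy⟩ : ∃ cy, cy = x3 * (-y2 / x2) + y3 - p3 * (-y1 / p1) := ⟨_, rfl⟩
  have hrel : ca • a + cb • b + cy • y = 0 := by
    have h4 : x3 • x + y3 • y - (b3 • b + p3 • p) = 0 := sub_eq_zero.mpr r3
    rw [hxe, hpe] at h4
    rw [← h4, hca, hcb, hcy]; module
  have hcy0 : cy ≠ 0 := by
    intro h0
    rw [h0, zero_smul, add_zero] at hrel
    obtain ⟨h1, h2⟩ := hind _ _ hrel
    have e : ca + cb + cy = x3 / x2 * (a2 + b2 - x2 - y2) + p3 / p1 * (y1 + p1 - a1 - b1)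
        + (x3 + y3 - b3 - p3) := by
      rw [hca, hcb, hcy]; field_simp; ring
    have i1 : 0 < x3 / x2 * (a2 + b2 - x2 - y2) := mul_pos (by positivity) (by linarith)
    have i2 : 0 < p3 / p1 * (y1 + p1 - a1 - b1) := mul_pos (by positivity) (by linarith)
    linarith
  obtain ⟨c, d, hyc⟩ : ∃ c d : ℝ, y = c • a + d • b := by
    refine ⟨-ca / cy, -cb / cy, ?_⟩
    have h3 : y = cy⁻¹ • (cy • y) := by rw [smul_smul, inv_mul_cancel₀ hcy0, one_smul]
    rw [eq_neg_of_add_eq_zero_right hrel] at h3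
    rw [h3]; module
  obtain ⟨e, f, hxc⟩ : ∃ e f : ℝ, x = e • a + f • b :=
    ⟨a2 / x2 + -y2 / x2 * c, b2 / x2 + -y2 / x2 * d, by rw [hxe, hyc]; module⟩
  obtain ⟨g, h, hpc⟩ : ∃ g h : ℝ, p = g • a + h • b :=
    ⟨a1 / p1 + -y1 / p1 * c, b1 / p1 + -y1 / p1 * d, by rw [hpe, hyc]; module⟩
  obtain ⟨e11, e12⟩ := hind (y1 * c + p1 * g - a1) (y1 * d + p1 * h - b1) (by
    have := sub_eq_zero.mpr r1
    rw [hyc, hpc] at this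
    rw [← this]; module)
  obtain ⟨e21, e22⟩ := hind (a2 - (x2 * e + y2 * c)) (b2 - (x2 * f + y2 * d)) (by
    have := sub_eq_zero.mpr r2
    rw [hyc, hxc] at this
    rw [← this]; module)
  obtain ⟨e31, e32⟩ := hind (x3 * e + y3 * c - p3 * g) (x3 * f + y3 * d - (b3 + p3 * h)) (by
    have := sub_eq_zero.mpr r3
    rw [hyc, hxc, hpc] at this
    rw [← this]; module)
  have hxy : ∀ α β : ℝ, α • x + β • y = (α * e + β * c) • a + (α * f + β * d) • b := by
    intro α β
    rw [hxc, hyc]; module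
  rcases planar_aux c d e f g h a1 b1 y1 p1 a2 b2 x2 y2 b3 p3 x3 y3 ha1 hb1 hy1 hp1 ha2 hb2 hx2 hy2
    hb3 hp3 hx3 hy3 (by linarith) (by linarith) (by linarith) (by linarith) (by linarith)
    (by linarith) with ⟨hc, hd⟩ | ⟨α, β, hα, hβ, q1, q2⟩ | ⟨α, β, hα, hβ, hs, q1, q2⟩ |
    ⟨hg, hh, α, β, hα, hβ, q1, q2⟩
  · exact hY c d hc hd hyc
  · exact hB α β hα hβ (by rw [hxy, q1, q2]; module)
  · exact hxy0 α β hα hβ hs (by rw [hxy, q1, q2]; module)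
  · exact hP g h α β hg hh hα hβ hpc (by rw [hxy, q1, q2]; exact hpc)

theorem cone_ne_zero (O A B : E3) (hO : O ∉ segment ℝ A B) (s t : ℝ) (hs : 0 ≤ s) (ht : 0 ≤ t)
    (hst : 0 < s + t) : s • (A - O) + t • (B - O) ≠ 0 := by
  intro h
  refine hO ⟨s / (s + t), t / (s + t), by positivity, by positivity, by field_simp, ?_⟩
  have h2 : s • A + t • B = (s + t) • O := by
    rw [← sub_eq_zero, ← h]; module
  have h3 : O = (s + t)⁻¹ • ((s + t) • O) := by rw [smul_smul, inv_mul_cancel₀ hst.ne', one_smul]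
  rw [← h2] at h3
  conv_rhs => rw [h3]
  module

/-- Non-realizability via a path: there is no configuration of points
`A, B, P, X, Y, Z` in `ℝ³` (with the segments `YP` and `AB`, `AB` and `XY`,
`XY` and `BP` disjoint, and a projection point `O` off all segments) whose radial
projection realizes the over/under pattern `YP // AB`, `AB // XY`, `XY // BP`. -/
theorem no_path_pattern (O A B P X Y Z : E3)
    (hO : O ∉ segment ℝ Y P ∪ segment ℝ A B ∪ segment ℝ X Y ∪ segment ℝ B P)
    (h1 : Disjoint (segment ℝ Y P) (segment ℝ A B))
    (h2 : Disjoint (segment ℝ A B) (segment ℝ X Y))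
    (h3 : Disjoint (segment ℝ X Y) (segment ℝ B P)) :
    ¬ (Over O Y P A B ∧ Over O A B X Y ∧ Over O X Y B P) := by
  rintro ⟨o1, o2, o3⟩
  simp only [Set.mem_union, not_or] at hO
  obtain ⟨⟨⟨hYP, hAB⟩, hXY⟩, hBP⟩ := hO
  obtain ⟨D1, y1, p1, a1, b1, hy1, hp1, ha1, hb1, l1, r1⟩ := over_rel O Y P A B hYP h1 o1
  obtain ⟨D2, a2, b2, x2, y2, ha2, hb2, hx2, hy2, l2, r2⟩ := over_rel O A B X Y hAB h2 o2
  obtain ⟨D3, x3, y3, b3, p3, hx3, hy3, hb3, hp3, l3, r3⟩ := over_rel O X Y B P hXY h3 o3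
  refine vec_main (A - O) (B - O) (P - O) (X - O) (Y - O) D1 D2 D3 (cone_ne_zero O A B hAB)
    (cone_ne_zero O X Y hXY) ?_ a1 b1 y1 p1 a2 b2 x2 y2 b3 p3 x3 y3 hy1 hp1 ha1 hb1 l1 r1
    ha2 hb2 hx2 hy2 l2 r2 hx3 hy3 hb3 hp3 l3 r3
  intro h0
  exact hYP ((sub_eq_zero.mp h0) ▸ right_mem_segment ℝ Y P)

end
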